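/- Consider the 2×2 matrix differential Riccati equation P'(t) + P(t)B₁₁ + P(t)B₁₂P(t) − B₂₁ − B₂₂P(t) = 0 with terminal condition P(T)=G, where B₁₁=[[−β,0],[0,0]], B₁₂=[[c,0],[1,0]], B₂₁=(1/(2η))[[β, φ+cβ],[0, 2ηβ]], B₂₂=(1/(2η))[[0,cβ],[0,2ηβ]], G=(1/(2η))[[0,c],[0,0]], with η,φ,β>0 and 0<c<√(2ηφ). Then this equation admits a unique C¹ solution on [0,T]. -/

import Mathlib

open Set Matrix

/-- The linear Hamiltonian-type system associated with the Riccati equation. -/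
def LinSys (η φ β c : ℝ) (x1 x2 y1 y2 : ℝ → ℝ) : Prop :=
  ∀ t, HasDerivAt x1 (-β * x1 t + c * y1 t) t ∧ HasDerivAt x2 (y1 t) t ∧
    HasDerivAt y1 ((1 / (2 * η)) * (β * x1 t + (φ + c * β) * x2 t + c * β * y2 t)) t ∧
    HasDerivAt y2 (β * x2 t + β * y2 t) t

theorem linSys_exists (η φ β c T : ℝ) (v : Fin 4 → ℝ) :
    ∃ x1 x2 y1 y2 : ℝ → ℝ, LinSys η φ β c x1 x2 y1 y2 ∧
      x1 T = v 0 ∧ x2 T = v 1 ∧ y1 T = v 2 ∧ y2 T = v 3 := by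
  let M : Matrix (Fin 4) (Fin 4) ℝ :=
    !![-β, 0, c, 0; 0, 0, 1, 0;
      (1 / (2 * η)) * β, (1 / (2 * η)) * (φ + c * β), 0, (1 / (2 * η)) * (c * β);
      0, β, 0, β]
  let L : (Fin 4 → ℝ) →L[ℝ] (Fin 4 → ℝ) := LinearMap.toContinuousLinearMap (Matrix.toLin' M)
  let f : ℝ → Fin 4 → ℝ := fun t => NormedSpace.exp ((t - T) • L) v
  have hf : ∀ t, HasDerivAt f (L (f t)) t := by
    intro t
    have h1 := hasDerivAt_exp_smul_const' (𝕂 := ℝ) L (t - T)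
    have h2 := h1.scomp t ((hasDerivAt_id t).sub_const T)
    have h3 := h2.clm_apply (hasDerivAt_const t v)
    simpa [f, Function.comp_def] using h3
  have hT : f T = v := by simp [f]
  have hL : ∀ w : Fin 4 → ℝ, L w = M *ᵥ w := fun w => by simp [L]
  have hi : ∀ i t, HasDerivAt (fun s => f s i) ((M *ᵥ f t) i) t := by
    intro i t
    have := hasDerivAt_pi.1 (hf t) i
    rwa [hL] at this
  refine ⟨fun t => f t 0, fun t => f t 1, fun t => f t 2, fun t => f t 3, ?_, ?_, ?_, ?_, ?_⟩
  · intro t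
    refine ⟨?_, ?_, ?_, ?_⟩
    · convert hi 0 t using 1
      simp [M, Matrix.mulVec, dotProduct, Fin.sum_univ_four]
    · convert hi 1 t using 1
      simp [M, Matrix.mulVec, dotProduct, Fin.sum_univ_four]
    · convert hi 2 t using 1
      simp [M, Matrix.mulVec, dotProduct, Fin.sum_univ_four]
      ring
    · convert hi 3 t using 1
      simp [M, Matrix.mulVec, dotProduct, Fin.sum_univ_four]
  all_goals simp [hT]

/-- Lyapunov argument: a solution with the right terminal values cannot have `x t = 0`. -/
theorem linSys_nonvanish (η φ β c T r : ℝ) (hη : 0 < η) (hβ : 0 < β) (hc0 : 0 < c)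
    (hr : c < 2 * r) (hφ : φ = 2 * r ^ 2 / η) (x1 x2 y1 y2 : ℝ → ℝ)
    (h : LinSys η φ β c x1 x2 y1 y2) (hy1 : y1 T = c / (2 * η) * x2 T) (hy2 : y2 T = 0)
    (t : ℝ) (ht : t ≤ T) (h1 : x1 t = 0) (h2 : x2 t = 0) : x1 T = 0 ∧ x2 T = 0 := by
  have hr0 : 0 < r := by linarith
  let V : ℝ → ℝ := fun t => x1 t * x1 t + (2 * r ^ 2 * c / (β * η)) * (x2 t * x2 t)
    - (c * r / (β * η)) * (x1 t * y2 t) - (2 * c * r / β) * (x2 t * y1 t)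
    + (c ^ 2 * r / (β * η)) * (x2 t * y2 t)
  have hV : ∀ t, HasDerivAt V (-2 * (β * (x1 t - c / (2 * β) * y1 t + c * r / (2 * β * η) * x2 t) ^ 2
      + c / (4 * β) * (4 * r - c) * (y1 t - r / η * x2 t) ^ 2)) t := by
    intro t
    obtain ⟨d1, d2, d3, d4⟩ := h t
    have := (((((d1.mul d1).add ((d2.mul d2).const_mul (2 * r ^ 2 * c / (β * η)))).sub
      ((d1.mul d4).const_mul (c * r / (β * η)))).sub
      ((d2.mul d3).const_mul (2 * c * r / β))).add
      ((d2.mul d4).const_mul (c ^ 2 * r / (β * η))))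
    refine this.congr_deriv ?_
    rw [hφ]
    field_simp
    ring
  have hanti : Antitone V := antitone_of_deriv_nonpos (fun s => (hV s).differentiableAt) (by
    intro s
    rw [(hV s).deriv]
    have : 0 < 4 * r - c := by linarith
    have : 0 ≤ (β * (x1 s - c / (2 * β) * y1 s + c * r / (2 * β * η) * x2 s) ^ 2
      + c / (4 * β) * (4 * r - c) * (y1 s - r / η * x2 s) ^ 2) := by positivity
    linarith)
  have h0 : V t = 0 := by simp [V, h1, h2]
  have hVT : V T = x1 T ^ 2 + c * r / (β * η) * (2 * r - c) * x2 T ^ 2 := by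
    simp only [V, hy1, hy2]
    field_simp
    ring
  have hle := hanti ht
  rw [h0, hVT] at hle
  have hk : 0 < c * r / (β * η) * (2 * r - c) := by
    have : 0 < 2 * r - c := by linarith
    positivity
  have a1 : 0 ≤ c * r / (β * η) * (2 * r - c) * x2 T ^ 2 := by positivity
  have a2 := sq_nonneg (x1 T)
  refine ⟨by nlinarith, ?_⟩
  have : c * r / (β * η) * (2 * r - c) * x2 T ^ 2 = 0 := by linarith
  rcases mul_eq_zero.1 this with h | h
  · exact absurd h hk.ne'
  · exact pow_eq_zero_iff (two_ne_zero) |>.1 h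

theorem linSys_comb {η φ β c : ℝ} {x1 x2 y1 y2 u1 u2 v1 v2 : ℝ → ℝ}
    (h : LinSys η φ β c x1 x2 y1 y2) (k : LinSys η φ β c u1 u2 v1 v2) (a b : ℝ) :
    LinSys η φ β c (fun t => a * x1 t + b * u1 t) (fun t => a * x2 t + b * u2 t)
      (fun t => a * y1 t + b * v1 t) (fun t => a * y2 t + b * v2 t) := by
  intro t
  obtain ⟨d1, d2, d3, d4⟩ := h t
  obtain ⟨e1, e2, e3, e4⟩ := k t
  refine ⟨((d1.const_mul a).add (e1.const_mul b)).congr_deriv (by ring),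
    ((d2.const_mul a).add (e2.const_mul b)).congr_deriv (by ring),
    ((d3.const_mul a).add (e3.const_mul b)).congr_deriv (by ring),
    ((d4.const_mul a).add (e4.const_mul b)).congr_deriv (by ring)⟩

theorem riccati_unique (T : ℝ) (B11 B12 B21 B22 : Matrix (Fin 2) (Fin 2) ℝ)
    (P Q : ℝ → Matrix (Fin 2) (Fin 2) ℝ)
    (hP : ∀ i j : Fin 2, ∀ t ∈ Icc (0 : ℝ) T,
        HasDerivWithinAt (fun t' => P t' i j)
          ((B21 + B22 * P t - P t * B11 - P t * B12 * P t) i j) (Icc 0 T) t)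
    (hQ : ∀ i j : Fin 2, ∀ t ∈ Icc (0 : ℝ) T,
        HasDerivWithinAt (fun t' => Q t' i j)
          ((B21 + B22 * Q t - Q t * B11 - Q t * B12 * Q t) i j) (Icc 0 T) t)
    (hPQ : P T = Q T) : ∀ t ∈ Icc (0 : ℝ) T, P t = Q t := by
  let F : (Fin 2 → Fin 2 → ℝ) → (Fin 2 → Fin 2 → ℝ) := fun p i j =>
    (B21 + B22 * Matrix.of p - Matrix.of p * B11 - Matrix.of p * B12 * Matrix.of p) i j
  have hF : ContDiff ℝ 1 F := by
    refine contDiff_pi.2 fun i => contDiff_pi.2 fun j => ?_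
    simp only [F, Matrix.sub_apply, Matrix.add_apply, Matrix.mul_apply, Fin.sum_univ_two,
      Matrix.of_apply]
    fun_prop
  let p : ℝ → Fin 2 → Fin 2 → ℝ := fun t i j => P t i j
  let q : ℝ → Fin 2 → Fin 2 → ℝ := fun t i j => Q t i j
  have hp : ∀ t ∈ Icc (0 : ℝ) T, HasDerivWithinAt p (F (p t)) (Icc 0 T) t := fun t ht =>
    hasDerivWithinAt_pi.2 fun i => hasDerivWithinAt_pi.2 fun j => hP i j t ht
  have hq : ∀ t ∈ Icc (0 : ℝ) T, HasDerivWithinAt q (F (q t)) (Icc 0 T) t := fun t ht =>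
    hasDerivWithinAt_pi.2 fun i => hasDerivWithinAt_pi.2 fun j => hQ i j t ht
  have cp : ContinuousOn p (Icc 0 T) := fun t ht => (hp t ht).continuousWithinAt
  have cq : ContinuousOn q (Icc 0 T) := fun t ht => (hq t ht).continuousWithinAt
  obtain ⟨R1, hR1⟩ := isCompact_Icc.exists_bound_of_continuousOn cp
  obtain ⟨R2, hR2⟩ := isCompact_Icc.exists_bound_of_continuousOn cq
  obtain ⟨K, hK⟩ := (hF.contDiffOn (s := Metric.closedBall 0 (max R1 R2))).exists_lipschitzOnWith
    one_ne_zero (convex_closedBall _ _) (isCompact_closedBall _ _)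
  have hmono : ∀ (f : ℝ → Fin 2 → Fin 2 → ℝ) f', ∀ t ∈ Ioc (0 : ℝ) T,
      HasDerivWithinAt f f' (Icc 0 T) t → HasDerivWithinAt f f' (Iic t) t := by
    intro f f' t ht h
    refine h.mono_of_mem_nhdsWithin ?_
    exact Filter.mem_of_superset (Icc_mem_nhdsLE ht.1) (Icc_subset_Icc le_rfl ht.2)
  have key : EqOn p q (Icc 0 T) := ODE_solution_unique_of_mem_Icc_left (v := fun _ => F)
    (s := fun _ => Metric.closedBall 0 (max R1 R2)) (K := K) (fun _ _ => hK) cp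
    (fun t ht => hmono _ _ t ht (hp t (Ioc_subset_Icc_self ht)))
    (fun t ht => by
      rw [mem_closedBall_zero_iff]
      exact (hR1 t (Ioc_subset_Icc_self ht)).trans (le_max_left _ _))
    cq
    (fun t ht => hmono _ _ t ht (hq t (Ioc_subset_Icc_self ht)))
    (fun t ht => by
      rw [mem_closedBall_zero_iff]
      exact (hR2 t (Ioc_subset_Icc_self ht)).trans (le_max_right _ _))
    hPQ
  intro t ht
  exact key ht

/-- The 2×2 matrix differential Riccati equation
`P' + PB₁₁ + PB₁₂P − B₂₁ − B₂₂P = 0`, `P(T) = G`, with the coefficient matrices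
from the LP's replication problem and `0 < c < √(2ηφ)`, admits a unique C¹
solution on `[0,T]` (derivatives taken entrywise). -/
theorem stmt_15 (T η φ β c : ℝ) (hT : 0 < T) (hη : 0 < η) (hφ : 0 < φ)
    (hβ : 0 < β) (hc0 : 0 < c) (hc : c < Real.sqrt (2 * η * φ))
    (B11 B12 B21 B22 G : Matrix (Fin 2) (Fin 2) ℝ)
    (hB11 : B11 = !![-β, 0; 0, 0])
    (hB12 : B12 = !![c, 0; 1, 0])
    (hB21 : B21 = (1 / (2 * η)) • !![β, φ + c * β; 0, 2 * η * β])
    (hB22 : B22 = (1 / (2 * η)) • !![0, c * β; 0, 2 * η * β])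
    (hG : G = (1 / (2 * η)) • !![0, c; 0, 0]) :
    (∃ P : ℝ → Matrix (Fin 2) (Fin 2) ℝ,
      (∀ i j : Fin 2, ∀ t ∈ Icc (0 : ℝ) T,
        HasDerivWithinAt (fun t' => P t' i j)
          ((B21 + B22 * P t - P t * B11 - P t * B12 * P t) i j) (Icc 0 T) t) ∧
      P T = G) ∧
    (∀ P Q : ℝ → Matrix (Fin 2) (Fin 2) ℝ,
      ((∀ i j : Fin 2, ∀ t ∈ Icc (0 : ℝ) T,
        HasDerivWithinAt (fun t' => P t' i j)
          ((B21 + B22 * P t - P t * B11 - P t * B12 * P t) i j) (Icc 0 T) t) ∧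
        P T = G) →
      ((∀ i j : Fin 2, ∀ t ∈ Icc (0 : ℝ) T,
        HasDerivWithinAt (fun t' => Q t' i j)
          ((B21 + B22 * Q t - Q t * B11 - Q t * B12 * Q t) i j) (Icc 0 T) t) ∧
        Q T = G) →
      ∀ t ∈ Icc (0 : ℝ) T, P t = Q t) := by
  refine ⟨?_, fun P Q hP hQ => riccati_unique T B11 B12 B21 B22 P Q hP.1 hQ.1
    (hP.2.trans hQ.2.symm)⟩
  obtain ⟨r, hr, hφr⟩ : ∃ r : ℝ, c < 2 * r ∧ φ = 2 * r ^ 2 / η := by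
    refine ⟨Real.sqrt (2 * η * φ) / 2, by linarith, ?_⟩
    rw [div_pow, Real.sq_sqrt (by positivity)]
    field_simp
  obtain ⟨x1, x2, y1, y2, hs, hx1, hx2, hy1, hy2⟩ := linSys_exists η φ β c T ![1, 0, 0, 0]
  obtain ⟨u1, u2, v1, v2, ks, hu1, hu2, hv1, hv2⟩ :=
    linSys_exists η φ β c T ![0, 1, c / (2 * η), 0]
  simp at hx1 hx2 hy1 hy2 hu1 hu2 hv1 hv2
  have hdet : ∀ t ≤ T, x1 t * u2 t - u1 t * x2 t ≠ 0 := by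
    intro t ht h0
    have key : ∀ a b : ℝ, a * x1 t + b * u1 t = 0 → a * x2 t + b * u2 t = 0 → a = 0 ∧ b = 0 := by
      intro a b e1 e2
      have := linSys_nonvanish η φ β c T r hη hβ hc0 hr hφr _ _ _ _ (linSys_comb hs ks a b)
        (by simp only [hy1, hv1, hx2, hu2]; ring) (by simp only [hy2, hv2]; ring) t ht e1 e2
      simpa [hx1, hx2, hu1, hu2] using this
    have k1 := key (u2 t) (-x2 t) (by linarith) (by ring)
    have k2 := key (u1 t) (-x1 t) (by ring) (by linarith)
    have k3 := key 1 0 (by linarith [k2.2]) (by linarith [k1.2])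
    exact one_ne_zero k3.1
  refine ⟨fun t => !![(y1 t * u2 t - v1 t * x2 t) / (x1 t * u2 t - u1 t * x2 t),
      (v1 t * x1 t - y1 t * u1 t) / (x1 t * u2 t - u1 t * x2 t);
      (y2 t * u2 t - v2 t * x2 t) / (x1 t * u2 t - u1 t * x2 t),
      (v2 t * x1 t - y2 t * u1 t) / (x1 t * u2 t - u1 t * x2 t)], ?_, ?_⟩
  · intro i j t ht
    have hd := hdet t ht.2
    obtain ⟨d1, d2, d3, d4⟩ := hs t
    obtain ⟨e1, e2, e3, e4⟩ := ks t
    have dd := (d1.mul e2).sub (e1.mul d2)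
    subst hB11 hB12 hB21 hB22
    fin_cases i <;> fin_cases j
    · refine HasDerivAt.hasDerivWithinAt ?_
      refine (((d3.mul e2).sub (e3.mul d2)).div dd hd).congr_deriv ?_
      simp [Matrix.mul_apply, Fin.sum_univ_two]
      generalize hD : x1 t * u2 t - u1 t * x2 t = D at hd ⊢
      field_simp
      rw [← hD]
      ring
    · refine HasDerivAt.hasDerivWithinAt ?_
      refine (((e3.mul d1).sub (d3.mul e1)).div dd hd).congr_deriv ?_
      simp [Matrix.mul_apply, Fin.sum_univ_two]
      generalize hD : x1 t * u2 t - u1 t * x2 t = D at hd ⊢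
      field_simp
      rw [← hD]
      ring
    · refine HasDerivAt.hasDerivWithinAt ?_
      refine (((d4.mul e2).sub (e4.mul d2)).div dd hd).congr_deriv ?_
      simp [Matrix.mul_apply, Fin.sum_univ_two]
      generalize hD : x1 t * u2 t - u1 t * x2 t = D at hd ⊢
      field_simp
      rw [← hD]
      ring
    · refine HasDerivAt.hasDerivWithinAt ?_
      refine (((e4.mul d1).sub (d4.mul e1)).div dd hd).congr_deriv ?_
      simp [Matrix.mul_apply, Fin.sum_univ_two]
      generalize hD : x1 t * u2 t - u1 t * x2 t = D at hd ⊢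
      field_simp
      rw [← hD]
      ring
  · subst hG
    ext i j
    fin_cases i <;> fin_cases j <;> simp [hx1, hx2, hy1, hy2, hu1, hu2, hv1, hv2]
    field_simp
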